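/- Let Q be a finite quiver and k a field. Every finitely generated projective right module over the path algebra kQ is isomorphic to a finite direct sum of the modules P_v = e_v kQ, v ∈ V. -/

import Mathlib

open Matrix BigOperators

set_option maxHeartbeats 1000000
set_option synthInstance.maxHeartbeats 1000000

/-- Paths in the quiver with arrow set `A`, vertex set `V`, and source/target maps. -/
inductive QPath {V A : Type} (src tgt : A → V) : V → V → Type where
  | nil (v : V) : QPath src tgt v v
  | cons {u w : V} (p : QPath src tgt u w) (a : A) (h : src a = w) : QPath src tgt u (tgt a)

namespace QPath
variable {V A : Type} {src tgt : A → V}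

/-- Concatenation of paths. -/
def comp {u v w : V} (p : QPath src tgt u v) : QPath src tgt v w → QPath src tgt u w
  | .nil _ => p
  | .cons q a h => .cons (p.comp q) a h

end QPath

variable (k : Type) [Field k] {V A : Type} [DecidableEq V] (src tgt : A → V)

/-- The set of all paths of the quiver. -/
abbrev TotalPath (src tgt : A → V) : Type := Σ u v : V, QPath src tgt u v

/-- The underlying `k`-vector space of the path algebra: the span of all paths. -/
abbrev PathVec : Type := TotalPath src tgt →₀ k

/-- Left multiplication by a path, as an endomorphism of the span of all paths. -/
noncomputable def pathEnd {u v : V} (p : QPath src tgt u v) :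
    Module.End k (PathVec k src tgt) :=
  Finsupp.lift (PathVec k src tgt) k (TotalPath src tgt) fun g =>
    if h : g.1 = v then Finsupp.single ⟨u, g.2.1, p.comp (h ▸ g.2.2)⟩ 1 else 0

/-- The path algebra `kQ`, realized as the subalgebra of endomorphisms of the span of
all paths generated by left multiplication by paths. -/
noncomputable def PathAlg : Subalgebra k (Module.End k (PathVec k src tgt)) :=
  Algebra.adjoin k (Set.range fun p : TotalPath src tgt => pathEnd k src tgt p.2.2)

set_option maxHeartbeats 1000000 in
set_option synthInstance.maxHeartbeats 400000 in
noncomputable instance pathAlgRing : Ring ↥(PathAlg k src tgt) :=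
  @Subalgebra.toRing k (Module.End k (PathVec k src tgt)) _ _ _ (PathAlg k src tgt)

/-- The idempotent `e_v ∈ kQ` given by the trivial path at the vertex `v`. -/
noncomputable def eIdem (v : V) : ↥(PathAlg k src tgt) :=
  ⟨pathEnd k src tgt (QPath.nil v),
    Algebra.subset_adjoin ⟨⟨v, v, QPath.nil v⟩, rfl⟩⟩

/-- The projective right `kQ`-module `P_v = e_v·kQ`, as a submodule of `kQ` viewed as a right
module over itself (i.e. a module over `kQᵐᵒᵖ`). -/
noncomputable def Pmod (v : V) :
    Submodule (↥(PathAlg k src tgt))ᵐᵒᵖ ↥(PathAlg k src tgt) where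
  carrier := {x | eIdem k src tgt v * x = x}
  add_mem' := by
    intro x y hx hy
    simp only [Set.mem_setOf_eq] at hx hy ⊢
    rw [mul_add, hx, hy]
  zero_mem' := mul_zero _
  smul_mem' := by
    intro r x hx
    simp only [Set.mem_setOf_eq] at hx ⊢
    rw [← MulOpposite.op_unop r, op_smul_eq_mul, ← mul_assoc, hx]

theorem exists_injective_append_monotone (B A : Type*) [Finite B] [Finite A] :
    ∃ key : B × List A → ℕ, Function.Injective key ∧
      ∀ b b' l l' m, key (b, l) ≤ key (b', l') → key (b, l ++ m) ≤ key (b', l' ++ m) := by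
  obtain ⟨N, ⟨e⟩⟩ := Finite.exists_equiv_fin (B ⊕ A)
  let f : A → ℕ := fun a => (e (.inr a)).val
  let g : B → ℕ := fun b => (e (.inl b)).val + 1
  have hf : ∀ a, f a < N + 1 := fun a => by simp only [f]; omega
  have hg : ∀ b, g b < N + 1 := fun b => by simp only [g]; omega
  have hf_inj : ∀ a a', f a = f a' → a = a' := fun a a' h => by
    simpa [f, Fin.val_inj] using h
  have hg_inj : ∀ b b', g b = g b' → b = b' := fun b b' h => by
    simpa [g, Fin.val_inj] using h
  let step : ℕ → A → ℕ := fun m a => m * (N + 1) + f a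
  have hpos : ∀ b (l : List A), 0 < l.foldl step (g b) := by
    intro b l
    induction l using List.reverseRecOn with
    | nil => simp [g]
    | append_singleton l a ih =>
      simp only [List.foldl_append, List.foldl_cons, List.foldl_nil, step]
      positivity
  have hbig : ∀ b b' (l : List A) a, g b ≠ (l ++ [a]).foldl step (g b') := by
    intro b b' l a h
    have h1 := hpos b' l
    have h2 := hg b
    simp only [List.foldl_append, List.foldl_cons, List.foldl_nil, step] at h h1
    nlinarith
  refine ⟨fun x => x.2.foldl step (g x.1), ?_, ?_⟩
  · rintro ⟨b, l⟩ ⟨b', l'⟩ h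
    induction l using List.reverseRecOn generalizing l' with
    | nil =>
      rcases List.eq_nil_or_concat' l' with rfl | ⟨l', a', rfl⟩
      · rw [hg_inj b b' h]
      · exact absurd h (hbig _ _ _ _)
    | append_singleton l a ih =>
      rcases List.eq_nil_or_concat' l' with rfl | ⟨l', a', rfl⟩
      · exact absurd h.symm (hbig _ _ _ _)
      · simp only [List.foldl_append, List.foldl_cons, List.foldl_nil] at h
        have h1 := congrArg (· / (N + 1)) h
        have h2 := congrArg (· % (N + 1)) h
        simp only [step, Nat.mul_add_mod_self_right, Nat.mod_eq_of_lt (hf _)] at h2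
        have h3 : ∀ m c, step m c / (N + 1) = m := fun m c => by
          simp only [step]
          rw [Nat.mul_comm, Nat.mul_add_div (by omega), Nat.div_eq_of_lt (hf c), Nat.add_zero]
        simp only [h3] at h1
        have := ih l' h1
        simp only [Prod.mk.injEq] at this ⊢
        exact ⟨this.1, by rw [this.2, hf_inj _ _ h2]⟩
  · intro b b' l l' m h
    simp only [List.foldl_append] at h ⊢
    generalize l.foldl step (g b) = c at h
    generalize l'.foldl step (g b') = c' at h
    induction m generalizing c c' with
    | nil => exact h
    | cons a m ih => exact ih _ _ (Nat.add_le_add_right (Nat.mul_le_mul_right _ h) _)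

namespace QPath

variable {V A : Type} {src tgt : A → V}

/-- The list of arrows of a path. -/
def arrows {u v : V} : QPath src tgt u v → List A
  | .nil _ => []
  | .cons p a _ => p.arrows ++ [a]

theorem arrows_comp {u v w : V} (p : QPath src tgt u v) (q : QPath src tgt v w) :
    (p.comp q).arrows = p.arrows ++ q.arrows := by
  induction q with
  | nil => simp [comp, arrows]
  | cons q a h ih => simp [comp, arrows, ih]

theorem sigma_eq_of_arrows_eq {u v v' : V} (p : QPath src tgt u v) (p' : QPath src tgt u v')
    (h : p.arrows = p'.arrows) :
    (⟨v, p⟩ : Σ v, QPath src tgt u v) = ⟨v', p'⟩ := by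
  induction p generalizing v' with
  | nil =>
    cases p' with
    | nil => rfl
    | cons p' a' h' => simp [arrows] at h
  | cons p a ha ih =>
    cases p' with
    | nil => simp [arrows] at h
    | cons p' a' h' =>
      simp only [arrows] at h
      obtain ⟨h1, h2⟩ := List.append_inj' h rfl
      obtain rfl : a = a' := by simpa using h2
      subst ha h'
      have := ih p' h1
      simp only [Sigma.mk.injEq, heq_eq_eq, true_and] at this
      rw [this]

theorem eq_of_arrows_eq {u v : V} {p p' : QPath src tgt u v} (h : p.arrows = p'.arrows) :
    p = p' := by
  simpa using sigma_eq_of_arrows_eq p p' h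

theorem comp_assoc {u v w x : V} (p : QPath src tgt u v) (q : QPath src tgt v w)
    (r : QPath src tgt w x) : (p.comp q).comp r = p.comp (q.comp r) :=
  eq_of_arrows_eq (by simp [arrows_comp])

theorem exists_comp_of_arrows_eq_append {u w : V} (p : QPath src tgt u w) (l m : List A)
    (h : p.arrows = l ++ m) :
    ∃ (v : V) (p' : QPath src tgt u v) (q : QPath src tgt v w),
      p'.arrows = l ∧ q.arrows = m := by
  induction p generalizing m with
  | nil =>
    simp only [arrows, List.nil_eq, List.append_eq_nil_iff] at h
    exact ⟨u, .nil u, .nil u, by simp [arrows, h]⟩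
  | cons p a ha ih =>
    rcases List.eq_nil_or_concat' m with rfl | ⟨m, b, rfl⟩
    · exact ⟨_, .cons p a ha, .nil _, by simpa using h, rfl⟩
    · rw [← List.append_assoc] at h
      obtain ⟨h1, h2⟩ := List.append_inj' h rfl
      obtain rfl : a = b := by simpa using h2
      obtain ⟨v, p', q, hp, hq⟩ := ih m h1
      exact ⟨v, p', .cons q a ha, hp, by simp [arrows, hq]⟩

end QPath

namespace TotalPath

variable {V A : Type} {src tgt : A → V}

theorem ext_arrows {p q : TotalPath src tgt} (h : p.1 = q.1)
    (h' : p.2.2.arrows = q.2.2.arrows) : p = q := by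
  obtain ⟨u, v, p⟩ := p
  obtain ⟨u', v', q⟩ := q
  obtain rfl : u = u' := h
  rw [QPath.sigma_eq_of_arrows_eq p q h']

/-- The trivial path at a vertex. -/
def nil (src tgt : A → V) (v : V) : TotalPath src tgt := ⟨v, v, .nil v⟩

/-- The relation expressing that the path `s` is the concatenation of `p` and `q`. -/
def IsComp (p q s : TotalPath src tgt) : Prop :=
  p.2.1 = q.1 ∧ s.1 = p.1 ∧ s.2.2.arrows = p.2.2.arrows ++ q.2.2.arrows

theorem exists_isComp {p q : TotalPath src tgt} (h : p.2.1 = q.1) : ∃ s, IsComp p q s := by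
  obtain ⟨u, v, p⟩ := p
  obtain ⟨u', v', q⟩ := q
  obtain rfl : v = u' := h
  exact ⟨⟨u, v', p.comp q⟩, rfl, rfl, QPath.arrows_comp p q⟩

theorem exists_isComp_of_arrows_isPrefix {p s : TotalPath src tgt} (h : s.1 = p.1)
    (h' : p.2.2.arrows <+: s.2.2.arrows) : ∃ q, IsComp p q s := by
  obtain ⟨u, v, p⟩ := p
  obtain ⟨u', w, s⟩ := s
  obtain rfl : u' = u := h
  obtain ⟨m, hm⟩ := h'
  obtain ⟨v', p', q, hp, hq⟩ := s.exists_comp_of_arrows_eq_append p.arrows m hm.symm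
  obtain ⟨rfl, h⟩ := Sigma.mk.inj (QPath.sigma_eq_of_arrows_eq p' p hp)
  exact ⟨⟨v', w, q⟩, rfl, rfl, by simp [hq, hm]⟩

theorem IsComp.left_unique {p p' q s : TotalPath src tgt} (h : IsComp p q s)
    (h' : IsComp p' q s) : p = p' :=
  ext_arrows (h.2.1.symm.trans h'.2.1) (List.append_cancel_right (h.2.2.symm.trans h'.2.2))

theorem IsComp.unique {p q s s' : TotalPath src tgt} (h : IsComp p q s)
    (h' : IsComp p q s') : s = s' :=
  ext_arrows (h.2.1.trans h'.2.1.symm) (h.2.2.trans h'.2.2.symm)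

theorem isComp_nil_right (p : TotalPath src tgt) : IsComp p (nil src tgt p.2.1) p :=
  ⟨rfl, rfl, by simp [nil, QPath.arrows]⟩

theorem isComp_nil_left (p : TotalPath src tgt) : IsComp (nil src tgt p.1) p p :=
  ⟨rfl, rfl, by simp [nil, QPath.arrows]⟩

end TotalPath

/-- A `k`-basis of a `k`-algebra indexed by paths, multiplying by concatenation. -/
structure IsPathBasis {k : Type} [Field k] {V A : Type} {src tgt : A → V} {R : Type} [Ring R]
    [Algebra k R] (b : Module.Basis (TotalPath src tgt) k R) : Prop where
  mul_eq : ∀ {p q s}, TotalPath.IsComp p q s → b p * b q = b s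
  mul_eq_zero : ∀ {p q : TotalPath src tgt}, p.2.1 ≠ q.1 → b p * b q = 0

namespace IsPathBasis

open TotalPath

variable {k : Type} [Field k] {V A : Type} {src tgt : A → V} {R : Type} [Ring R]
  [Algebra k R] {b : Module.Basis (TotalPath src tgt) k R} (hb : IsPathBasis b)
include hb

theorem repr_mul_of_isComp {p q s : TotalPath src tgt} (h : IsComp p q s) (r : R) :
    b.repr (r * b q) s = b.repr r p := by
  suffices H : (Finsupp.lapply s ∘ₗ b.repr.toLinearMap ∘ₗ LinearMap.mulRight k (b q) : R →ₗ[k] k)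
      = Finsupp.lapply p ∘ₗ b.repr.toLinearMap from LinearMap.congr_fun H r
  refine b.ext fun p' => ?_
  simp only [LinearMap.comp_apply, LinearMap.mulRight_apply, LinearEquiv.coe_coe,
    Finsupp.lapply_apply, Module.Basis.repr_self]
  by_cases hp : p'.2.1 = q.1
  · obtain ⟨s', hs'⟩ := exists_isComp hp
    rw [hb.mul_eq hs', b.repr_self]
    classical
    simp only [Finsupp.single_apply]
    refine if_congr ⟨?_, ?_⟩ rfl rfl
    · rintro rfl
      exact hs'.left_unique h
    · rintro rfl
      exact hs'.unique h
  · have : p' ≠ p := by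
      rintro rfl
      exact hp h.1
    rw [hb.mul_eq_zero hp]
    simp [this]

theorem exists_isComp_of_repr_mul_ne_zero {q s : TotalPath src tgt} {r : R}
    (h : b.repr (r * b q) s ≠ 0) : ∃ p, IsComp p q s ∧ b.repr r p ≠ 0 := by
  by_cases hp : ∃ p, IsComp p q s
  · obtain ⟨p, hp⟩ := hp
    exact ⟨p, hp, hb.repr_mul_of_isComp hp r ▸ h⟩
  · refine absurd ?_ h
    suffices H : (Finsupp.lapply s ∘ₗ b.repr.toLinearMap ∘ₗ LinearMap.mulRight k (b q) :
        R →ₗ[k] k) = 0 from LinearMap.congr_fun H r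
    refine b.ext fun p' => ?_
    simp only [LinearMap.comp_apply, LinearMap.mulRight_apply, LinearEquiv.coe_coe,
      Finsupp.lapply_apply, LinearMap.zero_apply]
    by_cases hp' : p'.2.1 = q.1
    · obtain ⟨s', hs'⟩ := exists_isComp hp'
      have : s' ≠ s := by
        rintro rfl
        exact hp ⟨p', hs'⟩
      rw [hb.mul_eq hs']
      simp [this]
    · simp [hb.mul_eq_zero hp']

theorem repr_nil_mul (v : V) (r : R) (p : TotalPath src tgt) (hp : p.1 ≠ v) :
    b.repr (b (nil src tgt v) * r) p = 0 := by
  suffices H : (Finsupp.lapply p ∘ₗ b.repr.toLinearMap ∘ₗ LinearMap.mulLeft k (b (nil src tgt v)) :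
      R →ₗ[k] k) = 0 from LinearMap.congr_fun H r
  refine b.ext fun q => ?_
  simp only [LinearMap.comp_apply, LinearMap.mulLeft_apply, LinearEquiv.coe_coe,
    Finsupp.lapply_apply, LinearMap.zero_apply]
  by_cases hq : v = q.1
  · subst hq
    have : q ≠ p := by
      rintro rfl
      exact hp rfl
    rw [hb.mul_eq (isComp_nil_left q)]
    simp [this]
  · rw [hb.mul_eq_zero hq]
    simp

theorem nil_mul_nil (v : V) :
    b (nil src tgt v) * b (nil src tgt v) = b (nil src tgt v) :=
  hb.mul_eq (isComp_nil_left (nil src tgt v))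

omit hb in
theorem repr_mul (x r : R) (s : TotalPath src tgt) :
    b.repr (x * r) s = ∑ q ∈ (b.repr r).support, b.repr r q * b.repr (x * b q) s := by
  conv_lhs => rw [← b.linearCombination_repr r]
  simp [Finsupp.linearCombination_apply, Finsupp.sum, Finset.mul_sum, Finsupp.finsetSum_apply]

variable {J : Type}

/-- The value of a weight function on words at a basis element of a free module. -/
def pathKey (key : (J × V) × List A → ℕ) (t : J × TotalPath src tgt) : ℕ :=
  key ((t.1, t.2.1), t.2.2.2.arrows)

omit hb in
theorem pathKey_injective {key : (J × V) × List A → ℕ} (hkey : Function.Injective key) :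
    Function.Injective (pathKey key : J × TotalPath src tgt → ℕ) := by
  rintro ⟨j, p⟩ ⟨j', p'⟩ h
  have := hkey h
  simp only [Prod.mk.injEq] at this
  rw [this.1.1, ext_arrows this.1.2 this.2]

/-- `t` is the basis element of greatest weight occurring in `y`. -/
def IsTip (b : Module.Basis (TotalPath src tgt) k R) (key : (J × V) × List A → ℕ)
    (y : J → R) (t : J × TotalPath src tgt) : Prop :=
  b.repr (y t.1) t.2 ≠ 0 ∧
    ∀ s : J × TotalPath src tgt, b.repr (y s.1) s.2 ≠ 0 → pathKey key s ≤ pathKey key t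

omit hb in
theorem exists_isTip [Finite J] (key : (J × V) × List A → ℕ) {y : J → R} (hy : y ≠ 0) :
    ∃ t, IsTip b key y t := by
  have hfin : {s : J × TotalPath src tgt | b.repr (y s.1) s.2 ≠ 0}.Finite := by
    refine (Set.finite_iUnion fun j : J =>
      ((b.repr (y j)).support.finite_toSet.image fun p => (j, p))).subset ?_
    rintro ⟨j, p⟩ h
    simpa using h
  obtain ⟨j, hj⟩ := Function.ne_iff.mp hy
  have hj' : b.repr (y j) ≠ 0 := by simpa using hj
  obtain ⟨p, hp⟩ := Finsupp.ne_iff.mp hj'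
  obtain ⟨t, ht, hmax⟩ := hfin.exists_maximalFor (pathKey key) _ ⟨(j, p), hp⟩
  refine ⟨t, ht, fun s hs => ?_⟩
  by_contra h
  exact h (hmax hs (not_le.mp h).le)

section Family

variable {ι : Type} [Fintype ι] (P : V → Submodule Rᵐᵒᵖ R) (v : ι → V) (x : ι → J → R)

/-- The map from a sum of vertex modules determined by a family of elements. -/
def familyMap : ((i : ι) → P (v i)) →ₗ[Rᵐᵒᵖ] (J → R) where
  toFun r j := ∑ i, x i j * (r i : R)
  map_add' r s := by
    funext j
    simp [mul_add, Finset.sum_add_distrib]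
  map_smul' a r := by
    funext j
    simp [Finset.sum_mul, mul_assoc, MulOpposite.smul_eq_mul_unop]

variable {P v x} {key : (J × V) × List A → ℕ} {t : ι → J × TotalPath src tgt}

theorem familyMap_injective (hP : ∀ v r, r ∈ P v → b (nil src tgt v) * r = r)
    (hkey : Function.Injective key)
    (hmono : ∀ c c' l l' m, key (c, l) ≤ key (c', l') → key (c, l ++ m) ≤ key (c', l' ++ m))
    (htip : ∀ i, IsTip b key (x i) (t i)) (htgt : ∀ i, (t i).2.2.1 = v i)
    (hpre : ∀ i i', (t i).1 = (t i').1 → (t i).2.1 = (t i').2.1 →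
      (t i).2.2.2.arrows <+: (t i').2.2.2.arrows → i = i') :
    Function.Injective (familyMap P v x) := by
  classical
  rw [injective_iff_map_eq_zero]
  intro r hr
  by_contra hne
  let w : ι × TotalPath src tgt → ℕ := fun z =>
    key (((t z.1).1, (t z.1).2.1), (t z.1).2.2.2.arrows ++ z.2.2.2.arrows)
  have hw : ∀ z z' : ι × TotalPath src tgt, z.2.1 = v z.1 → z'.2.1 = v z'.1 → w z = w z' →
      z = z' := by
    rintro ⟨i, q⟩ ⟨i', q'⟩ hq hq' h
    have h' := hkey h
    simp only [Prod.mk.injEq] at h'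
    obtain ⟨⟨h1, h2⟩, h3⟩ := h'
    have hii : i = i' := by
      rcases List.prefix_or_prefix_of_prefix (List.prefix_append (t i).2.2.2.arrows q.2.2.arrows)
        (h3 ▸ List.prefix_append (t i').2.2.2.arrows q'.2.2.arrows) with h4 | h4
      · exact hpre i i' h1 h2 h4
      · exact (hpre i' i h1.symm h2.symm h4).symm
    subst hii
    exact congrArg (Prod.mk i) (ext_arrows (hq.trans hq'.symm) (List.append_cancel_left h3))
  have hfin : {z : ι × TotalPath src tgt | b.repr (r z.1 : R) z.2 ≠ 0}.Finite := by
    refine (Set.finite_iUnion fun i : ι =>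
      ((b.repr (r i : R)).support.finite_toSet.image fun p => (i, p))).subset ?_
    rintro ⟨j, p⟩ h
    simpa using h
  have hstart : ∀ z : ι × TotalPath src tgt, b.repr (r z.1 : R) z.2 ≠ 0 → z.2.1 = v z.1 := by
    intro z hz
    by_contra h
    exact hz (hP _ _ (r z.1).2 ▸ hb.repr_nil_mul (v z.1) (r z.1 : R) z.2 h)
  obtain ⟨i₀, hi₀⟩ := Function.ne_iff.mp hne
  have hi₀' : b.repr (r i₀ : R) ≠ 0 := by simpa using hi₀
  obtain ⟨q₀, hq₀⟩ := Finsupp.ne_iff.mp hi₀'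
  obtain ⟨⟨i, q⟩, hz, hmax⟩ := hfin.exists_maximalFor w _ ⟨(i₀, q₀), hq₀⟩
  replace hz : b.repr (r i : R) q ≠ 0 := hz
  replace hmax : ∀ z : ι × TotalPath src tgt, b.repr (r z.1 : R) z.2 ≠ 0 → w z ≤ w (i, q) := by
    intro z hz
    by_contra h
    exact h (hmax hz (not_le.mp h).le)
  obtain ⟨s, hs⟩ := exists_isComp ((htgt i).trans (hstart (i, q) hz).symm)
  have hzero : ∀ i' q', b.repr (r i' : R) q' ≠ 0 → (i', q') ≠ (i, q) →
      b.repr (x i' (t i).1 * b q') s = 0 := by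
    intro i' q' hz' hne'
    by_contra h
    obtain ⟨p', hp', hc⟩ := hb.exists_isComp_of_repr_mul_ne_zero h
    refine hne' (hw _ _ (hstart (i', q') hz') (hstart (i, q) hz) (le_antisymm (hmax _ hz') ?_))
    have h1 := hmono _ _ _ _ q'.2.2.arrows ((htip i').2 ((t i).1, p') hc)
    simp only [← hp'.2.2, ← hp'.2.1] at h1
    simpa only [w, ← hs.2.2, ← hs.2.1] using h1
  have hcoef : b.repr (familyMap P v x r (t i).1) s = 0 := by simp [hr]
  simp only [familyMap, LinearMap.coe_mk, AddHom.coe_mk, map_sum, Finsupp.finsetSum_apply] at hcoef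
  simp_rw [fun i' => repr_mul (b := b) (x i' (t i).1) (r i' : R) s] at hcoef
  rw [Finset.sum_eq_single i, Finset.sum_eq_single q, hb.repr_mul_of_isComp hs] at hcoef
  · exact mul_ne_zero hz (htip i).1 hcoef
  · intro q' hq' hne'
    rw [hzero i q' (by simpa using hq') (by simpa using hne'), mul_zero]
  · intro h
    simp [Finsupp.notMem_support_iff.mp h]
  · intro i' _ hne'
    refine Finset.sum_eq_zero fun q' hq' => ?_
    rw [hzero i' q' (by simpa using hq') (by simp [hne']), mul_zero]
  · simp

omit hb in
theorem range_familyMap (hP : ∀ v, b (nil src tgt v) ∈ P v)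
    (hx : ∀ i, MulOpposite.op (b (nil src tgt (v i))) • x i = x i) :
    LinearMap.range (familyMap P v x) = Submodule.span Rᵐᵒᵖ (Set.range x) := by
  classical
  apply le_antisymm
  · rintro _ ⟨r, rfl⟩
    have : familyMap P v x r = ∑ i, MulOpposite.op (r i : R) • x i := by
      funext j
      simp [familyMap]
    rw [this]
    exact Submodule.sum_mem _ fun i _ =>
      Submodule.smul_mem _ _ (Submodule.subset_span ⟨i, rfl⟩)
  · rw [Submodule.span_le]
    rintro _ ⟨i, rfl⟩
    refine ⟨Pi.single i ⟨b (nil src tgt (v i)), hP _⟩, ?_⟩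
    funext j
    conv_rhs => rw [← hx i]
    simp only [familyMap, LinearMap.coe_mk, AddHom.coe_mk, Pi.smul_apply, op_smul_eq_mul]
    rw [Finset.sum_eq_single i]
    · simp
    · intro i' _ h
      simp [Pi.single_eq_of_ne h]
    · simp

end Family

/-- The basis elements occurring as tips of elements of a submodule. -/
def tips (b : Module.Basis (TotalPath src tgt) k R) (key : (J × V) × List A → ℕ)
    (N : Submodule Rᵐᵒᵖ (J → R)) : Set (J × TotalPath src tgt) :=
  {t | ∃ y ∈ N, IsTip b key y t}

/-- The tips of a submodule having no proper prefix among the tips. -/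
def minimalTips (b : Module.Basis (TotalPath src tgt) k R) (key : (J × V) × List A → ℕ)
    (N : Submodule Rᵐᵒᵖ (J → R)) : Set (J × TotalPath src tgt) :=
  {t | t ∈ tips b key N ∧ ∀ t' ∈ tips b key N, t'.1 = t.1 → t'.2.1 = t.2.1 →
    t'.2.2.2.arrows <+: t.2.2.2.arrows → t' = t}

omit hb in
theorem exists_minimalTips {key : (J × V) × List A → ℕ} {N : Submodule Rᵐᵒᵖ (J → R)}
    {t : J × TotalPath src tgt} (ht : t ∈ tips b key N) :
    ∃ t₀ ∈ minimalTips b key N, t₀.1 = t.1 ∧ t₀.2.1 = t.2.1 ∧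
      t₀.2.2.2.arrows <+: t.2.2.2.arrows := by
  induction h : t.2.2.2.arrows.length using Nat.strong_induction_on generalizing t with
  | _ n ih =>
    by_cases hmin : t ∈ minimalTips b key N
    · exact ⟨t, hmin, rfl, rfl, List.prefix_rfl⟩
    · have : ∃ t' ∈ tips b key N, t'.1 = t.1 ∧ t'.2.1 = t.2.1 ∧
          t'.2.2.2.arrows <+: t.2.2.2.arrows ∧ t' ≠ t := by
        by_contra! hc
        exact hmin ⟨ht, hc⟩
      obtain ⟨t', ht', h1, h2, h3, h4⟩ := this
      have hlt : t'.2.2.2.arrows.length < n := by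
        refine h ▸ lt_of_le_of_ne h3.length_le fun he => h4 ?_
        exact Prod.ext h1 (ext_arrows h2 (h3.eq_of_length he))
      obtain ⟨t₀, ht₀, g1, g2, g3⟩ := ih _ hlt ht' rfl
      exact ⟨t₀, ht₀, g1.trans h1, g2.trans h2, g3.trans h3⟩

theorem exists_uniform_of_mem_tips {key : (J × V) × List A → ℕ}
    {N : Submodule Rᵐᵒᵖ (J → R)} {t : J × TotalPath src tgt} (ht : t ∈ tips b key N) :
    ∃ y ∈ N, IsTip b key y t ∧ MulOpposite.op (b (nil src tgt t.2.2.1)) • y = y := by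
  obtain ⟨y, hy, h1, h2⟩ := ht
  refine ⟨MulOpposite.op (b (nil src tgt t.2.2.1)) • y, N.smul_mem _ hy, ⟨?_, ?_⟩, ?_⟩
  · simpa [hb.repr_mul_of_isComp (isComp_nil_right t.2)] using h1
  · intro s hs
    simp only [Pi.smul_apply, op_smul_eq_mul] at hs
    obtain ⟨p, hp, hc⟩ := hb.exists_isComp_of_repr_mul_ne_zero hs
    have : p = s.2 := ext_arrows hp.2.1.symm (by simp [hp.2.2, nil, QPath.arrows])
    exact h2 s (this ▸ hc)
  · rw [smul_smul, ← MulOpposite.op_mul, hb.nil_mul_nil]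

theorem span_eq_of_isTip_minimalTips [Finite J] {key : (J × V) × List A → ℕ}
    {N : Submodule Rᵐᵒᵖ (J → R)} (hkey : Function.Injective key)
    (hmono : ∀ c c' l l' m, key (c, l) ≤ key (c', l') → key (c, l ++ m) ≤ key (c', l' ++ m))
    (x : minimalTips b key N → J → R) (hxN : ∀ t, x t ∈ N) (hx : ∀ t, IsTip b key (x t) t.1) :
    Submodule.span Rᵐᵒᵖ (Set.range x) = N := by
  apply le_antisymm
  · rw [Submodule.span_le]
    rintro _ ⟨t, rfl⟩
    exact hxN t
  · intro y hy
    by_cases hy0 : y = 0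
    · exact hy0 ▸ Submodule.zero_mem _
    obtain ⟨s, hs⟩ := exists_isTip (b := b) key hy0
    induction hn : pathKey key s using Nat.strong_induction_on generalizing y s with
    | _ n ih =>
      obtain ⟨t, ht, h1, h2, h3⟩ := exists_minimalTips ⟨y, hy, hs⟩
      obtain ⟨q, hq⟩ := exists_isComp_of_arrows_isPrefix h2.symm h3
      let z : J → R := x ⟨t, ht⟩
      have hzt : IsTip b key z t := hx ⟨t, ht⟩
      let c : k := b.repr (y s.1) s.2 / b.repr (z t.1) t.2
      let z' : J → R := MulOpposite.op (c • b q) • z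
      have hz'mem : z' ∈ Submodule.span Rᵐᵒᵖ (Set.range x) :=
        Submodule.smul_mem _ _ (Submodule.subset_span ⟨_, rfl⟩)
      have hz'N : z' ∈ N := N.smul_mem _ (hxN _)
      have hrepr : ∀ j p, b.repr (z' j) p = c * b.repr (z j * b q) p := by
        intro j p
        simp [z']
      suffices h : y - z' ∈ Submodule.span Rᵐᵒᵖ (Set.range x) by
        simpa using Submodule.add_mem _ h hz'mem
      by_cases hyz : y - z' = 0
      · exact hyz ▸ Submodule.zero_mem _
      obtain ⟨s', hs'⟩ := exists_isTip (b := b) key hyz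
      have hsub : ∀ j p, b.repr ((y - z') j) p = b.repr (y j) p - c * b.repr (z j * b q) p := by
        intro j p
        rw [← hrepr]
        simp
      refine ih _ ?_ (N.sub_mem hy hz'N) hyz s' hs' rfl
      rw [← hn]
      refine lt_of_le_of_ne ?_ fun he => ?_
      · by_cases hys : b.repr (y s'.1) s'.2 = 0
        · have h4 := hs'.1
          rw [hsub, hys, zero_sub] at h4
          obtain ⟨p, hp, hc⟩ := hb.exists_isComp_of_repr_mul_ne_zero
            (right_ne_zero_of_mul (neg_ne_zero.mp h4))
          have h5 := hmono _ _ _ _ q.2.2.arrows (hzt.2 (s'.1, p) hc)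
          simp only [← hp.2.2, ← hp.2.1, ← hq.2.2, ← hq.2.1, h1] at h5
          exact h5
        · exact hs.2 s' hys
      · obtain rfl := pathKey_injective hkey he
        apply hs'.1
        have h6 : c * b.repr (z t.1) t.2 = b.repr (y s'.1) s'.2 := div_mul_cancel₀ _ hzt.1
        rw [hsub, hb.repr_mul_of_isComp hq, ← h6, ← h1, sub_self]

theorem exists_linearEquiv_of_fg [Finite J] [Finite V] [Finite A] (P : V → Submodule Rᵐᵒᵖ R)
    (hP : ∀ v r, r ∈ P v ↔ b (nil src tgt v) * r = r) (N : Submodule Rᵐᵒᵖ (J → R))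
    (hN : N.FG) :
    ∃ c : V → ℕ, Nonempty (N ≃ₗ[Rᵐᵒᵖ] ((i : Σ v : V, Fin (c v)) → P i.1)) := by
  classical
  obtain ⟨key, hkey, hmono⟩ := exists_injective_append_monotone (J × V) A
  have hex : ∀ t : minimalTips b key N, ∃ y ∈ N, IsTip b key y t.1 ∧
      MulOpposite.op (b (nil src tgt t.1.2.2.1)) • y = y :=
    fun t => hb.exists_uniform_of_mem_tips t.2.1
  choose x hxN hxt hxe using hex
  have hspan := hb.span_eq_of_isTip_minimalTips hkey hmono x hxN hxt
  obtain ⟨I, hI⟩ : ∃ I : Finset (minimalTips b key N),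
      Submodule.span Rᵐᵒᵖ (x '' (I : Set (minimalTips b key N))) = N := by
    rw [← hspan] at hN
    obtain ⟨S, hS, hS'⟩ := (Submodule.fg_span_iff_fg_span_finset_subset _).1 hN
    obtain ⟨I, -, rfl⟩ := Finset.subset_set_image_iff.1 (Set.image_univ ▸ hS)
    exact ⟨I, by rw [← Finset.coe_image, ← hS', hspan]⟩
  let φ : I → V := fun t => t.1.1.2.2.1
  let c : V → ℕ := fun v => Fintype.card {t : I // φ t = v}
  have : Fintype V := Fintype.ofFinite V
  let e : (Σ v : V, Fin (c v)) ≃ I :=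
    (Equiv.sigmaCongrRight fun v => (Fintype.equivFin {t : I // φ t = v}).symm).trans
      (Equiv.sigmaFiberEquiv φ)
  have he : ∀ i, φ (e i) = i.1 := fun i =>
    ((Fintype.equivFin {t : I // φ t = i.1}).symm i.2).2
  let X : (Σ v : V, Fin (c v)) → J → R := fun i => x (e i)
  have hinj : Function.Injective (familyMap P (fun i : Σ v : V, Fin (c v) => i.1) X) := by
    refine hb.familyMap_injective (t := fun i => (e i).1.1) (fun v r => (hP v r).1) hkey hmono
      (fun i => hxt _) he fun i i' h1 h2 h3 => ?_
    exact e.injective (Subtype.ext (Subtype.ext ((e i').1.2.2 _ (e i).1.2.1 h1 h2 h3)))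
  have hrange : LinearMap.range (familyMap P (fun i : Σ v : V, Fin (c v) => i.1) X) = N := by
    rw [range_familyMap (b := b) (fun v => (hP v _).2 (hb.nil_mul_nil v))
      ?_, ← hI]
    · congr 1
      ext y
      constructor
      · rintro ⟨i, rfl⟩
        exact ⟨(e i).1, (e i).2, rfl⟩
      · rintro ⟨t, ht, rfl⟩
        exact ⟨e.symm ⟨t, ht⟩, by simp [X]⟩
    · intro i
      exact he i ▸ hxe (e i).1
  exact ⟨c, ⟨((LinearEquiv.ofInjective _ hinj).trans (LinearEquiv.ofEq _ _ hrange)).symm⟩⟩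

end IsPathBasis

section PathAlgebra

open TotalPath

variable {k : Type} [Field k] {V A : Type} [DecidableEq V] {src tgt : A → V}

theorem pathEnd_single {u v w : V} (p : QPath src tgt u v) (q : QPath src tgt v w) :
    pathEnd k src tgt p (Finsupp.single ⟨v, w, q⟩ 1) = Finsupp.single ⟨u, w, p.comp q⟩ 1 := by
  simp [pathEnd]

theorem pathEnd_single_of_ne {u v : V} (p : QPath src tgt u v) {g : TotalPath src tgt}
    (h : g.1 ≠ v) : pathEnd k src tgt p (Finsupp.single g 1) = 0 := by
  simp [pathEnd, h]

theorem pathEnd_mul {u v w : V} (p : QPath src tgt u v) (q : QPath src tgt v w) :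
    pathEnd k src tgt p * pathEnd k src tgt q = pathEnd k src tgt (p.comp q) := by
  refine Finsupp.lhom_ext' fun g => LinearMap.ext_ring ?_
  obtain ⟨w', x, g⟩ := g
  simp only [LinearMap.comp_apply, Finsupp.lsingle_apply, Module.End.mul_apply]
  by_cases h : w' = w
  · subst h
    rw [pathEnd_single, pathEnd_single, pathEnd_single, QPath.comp_assoc]
  · rw [pathEnd_single_of_ne _ h, pathEnd_single_of_ne _ h, map_zero]

theorem pathEnd_mul_of_ne {u v v' w : V} (p : QPath src tgt u v) (q : QPath src tgt v' w)
    (h : v ≠ v') : pathEnd k src tgt p * pathEnd k src tgt q = 0 := by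
  refine Finsupp.lhom_ext' fun g => LinearMap.ext_ring ?_
  obtain ⟨w', x, g⟩ := g
  simp only [LinearMap.comp_apply, Finsupp.lsingle_apply, Module.End.mul_apply]
  by_cases h' : w' = w
  · subst h'
    rw [pathEnd_single, pathEnd_single_of_ne _ h.symm]
    rfl
  · rw [pathEnd_single_of_ne _ h', map_zero]
    rfl

theorem sum_pathEnd_nil [Fintype V] :
    ∑ v : V, pathEnd k src tgt (QPath.nil v) = 1 := by
  refine Finsupp.lhom_ext' fun g => LinearMap.ext_ring ?_
  obtain ⟨u, w, g⟩ := g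
  simp only [LinearMap.comp_apply, Finsupp.lsingle_apply, LinearMap.sum_apply,
    Module.End.one_apply]
  rw [Finset.sum_eq_single u]
  · rw [pathEnd_single, QPath.eq_of_arrows_eq (p := (QPath.nil u).comp g) (p' := g)
      (by simp [QPath.arrows_comp, QPath.arrows])]
  · intro v _ hv
    exact pathEnd_single_of_ne _ (Ne.symm hv)
  · simp

variable (k) in
theorem linearIndependent_pathEnd [Fintype V] :
    LinearIndependent k fun p : TotalPath src tgt => pathEnd k src tgt p.2.2 := by
  refine LinearIndependent.of_comp
    (LinearMap.applyₗ (∑ v : V, Finsupp.single (nil src tgt v) (1 : k))) ?_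
  convert (Finsupp.basisSingleOne (R := k) (ι := TotalPath src tgt)).linearIndependent
    using 1
  funext p
  obtain ⟨u, v, p⟩ := p
  rw [Finsupp.coe_basisSingleOne]
  change pathEnd k src tgt p (∑ w : V, Finsupp.single (nil src tgt w) (1 : k)) = _
  rw [map_sum, Finset.sum_eq_single v]
  · exact pathEnd_single p (QPath.nil v)
  · intro w _ hw
    exact pathEnd_single_of_ne p (g := nil src tgt w) hw
  · simp

variable (k src tgt) in
theorem span_pathEnd [Fintype V] :
    Submodule.span k (Set.range fun p : TotalPath src tgt => pathEnd k src tgt p.2.2) =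
      Subalgebra.toSubmodule (PathAlg k src tgt) := by
  set S := Set.range fun p : TotalPath src tgt => pathEnd k src tgt p.2.2 with hS
  apply le_antisymm
  · rw [Submodule.span_le]
    exact Algebra.subset_adjoin
  · have hone : (1 : Module.End k (PathVec k src tgt)) ∈ Submodule.span k S := by
      rw [← sum_pathEnd_nil]
      exact Submodule.sum_mem _ fun v _ => Submodule.subset_span ⟨nil src tgt v, rfl⟩
    have hmul : Submodule.span k S * Submodule.span k S ≤ Submodule.span k S := by
      rw [Submodule.span_mul_span, Submodule.span_le]
      rintro _ ⟨_, ⟨⟨u, v, p⟩, rfl⟩, _, ⟨⟨v', w, q⟩, rfl⟩, rfl⟩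
      by_cases h : v = v'
      · subst h
        exact Submodule.subset_span ⟨⟨u, w, p.comp q⟩, (pathEnd_mul p q).symm⟩
      · simp [pathEnd_mul_of_ne p q h]
    intro x hx
    refine Algebra.adjoin_induction (fun y hy => Submodule.subset_span hy) (fun r => ?_)
      (fun _ _ _ _ => Submodule.add_mem _)
      (fun _ _ _ _ hx hy => hmul (Submodule.mul_mem_mul hx hy)) hx
    rw [Algebra.algebraMap_eq_smul_one]
    exact Submodule.smul_mem _ _ hone

variable (k src tgt) in
/-- The basis of the path algebra consisting of all paths. -/
noncomputable def pathBasis [Fintype V] :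
    Module.Basis (TotalPath src tgt) k (PathAlg k src tgt) :=
  (Module.Basis.span (linearIndependent_pathEnd k)).map
    (LinearEquiv.ofEq _ _ (span_pathEnd k src tgt))

theorem coe_pathBasis [Fintype V] (p : TotalPath src tgt) :
    (pathBasis k src tgt p : Module.End k (PathVec k src tgt)) = pathEnd k src tgt p.2.2 := by
  rw [pathBasis, Module.Basis.map_apply]
  exact congrArg Subtype.val (Module.Basis.span_apply (linearIndependent_pathEnd k) p)

theorem isPathBasis_pathBasis [Fintype V] : IsPathBasis (pathBasis k src tgt) where
  mul_eq {p q s} h := by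
    obtain ⟨u, v, p⟩ := p
    obtain ⟨v', w, q⟩ := q
    obtain rfl : v = v' := h.1
    obtain rfl : s = ⟨u, w, p.comp q⟩ := h.unique ⟨rfl, rfl, QPath.arrows_comp p q⟩
    refine Subtype.ext ?_
    refine Eq.trans ?_ (coe_pathBasis _).symm
    refine Eq.trans ?_ (pathEnd_mul p q)
    exact congrArg₂ (· * ·) (coe_pathBasis _) (coe_pathBasis _)
  mul_eq_zero {p q} h := by
    refine Subtype.ext ?_
    refine Eq.trans ?_ (pathEnd_mul_of_ne p.2.2 q.2.2 h)
    exact congrArg₂ (· * ·) (coe_pathBasis _) (coe_pathBasis _)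

theorem mem_Pmod_iff [Fintype V] (v : V) (r : PathAlg k src tgt) :
    r ∈ Pmod k src tgt v ↔ pathBasis k src tgt (nil src tgt v) * r = r := by
  have : eIdem k src tgt v = pathBasis k src tgt (nil src tgt v) :=
    Subtype.ext (coe_pathBasis (nil src tgt v)).symm
  rw [← this]
  rfl

end PathAlgebra

/-- The regular left module over the opposite ring is the ring as a right module. -/
def MulOpposite.unopLinearEquivSelf (R : Type*) [Ring R] : Rᵐᵒᵖ ≃ₗ[Rᵐᵒᵖ] R where
  toFun := MulOpposite.unop
  invFun := MulOpposite.op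
  map_add' _ _ := rfl
  map_smul' _ _ := rfl
  left_inv _ := rfl
  right_inv _ := rfl

/-- Every finitely generated projective right module over the path algebra
`kQ` of a finite quiver is isomorphic to a finite direct sum of the modules `P_v = e_v·kQ`. -/
theorem fg_projective_module_iso_sum_of_pathProjectives
    [Fintype V] [Fintype A]
    (M : Type) [AddCommGroup M] [Module (↥(PathAlg k src tgt))ᵐᵒᵖ M]
    [Module.Finite (↥(PathAlg k src tgt))ᵐᵒᵖ M]
    [Module.Projective (↥(PathAlg k src tgt))ᵐᵒᵖ M] :
    ∃ c : V → ℕ, Nonempty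
      (M ≃ₗ[(↥(PathAlg k src tgt))ᵐᵒᵖ] ((i : Σ v : V, Fin (c v)) → ↥(Pmod k src tgt i.1))) := by
  obtain ⟨n, f, g, -, hg, -⟩ := Module.Finite.exists_comp_eq_id_of_projective
    (↥(PathAlg k src tgt))ᵐᵒᵖ M
  let u := LinearEquiv.piCongrRight fun _ : Fin n =>
    MulOpposite.unopLinearEquivSelf ↥(PathAlg k src tgt)
  let h : M →ₗ[(↥(PathAlg k src tgt))ᵐᵒᵖ] (Fin n → ↥(PathAlg k src tgt)) := u.toLinearMap ∘ₗ g
  have hh : Function.Injective h := u.injective.comp hg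
  obtain ⟨c, ⟨e⟩⟩ := isPathBasis_pathBasis.exists_linearEquiv_of_fg (Pmod k src tgt)
    mem_Pmod_iff (LinearMap.range h) (Module.Finite.iff_fg.1 inferInstance)
  exact ⟨c, ⟨(LinearEquiv.ofInjective h hh).trans e⟩⟩
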